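/- Binary Darboux transformation (coordinate form of the main theorem). Let U ⊆ ℝⁿ be open and N₁^μ_ν, N₂^μ_ν (μ,ν = 1,…,n) smooth real functions on U such that for every pair (i,j) ∈ {(1,1),(1,2),(2,2)} and all μ,ν,λ: Σ_κ [ N_i^κ_μ ∂_κ N_j^λ_ν − N_i^κ_ν ∂_κ N_j^λ_μ + N_j^κ_μ ∂_κ N_i^λ_ν − N_j^κ_ν ∂_κ N_i^λ_μ + N_i^λ_κ (∂_ν N_j^κ_μ − ∂_μ N_j^κ_ν) + N_j^λ_κ (∂_ν N_i^κ_μ − ∂_μ N_i^κ_ν) ] = 0 (vanishing Frölicher–Nijenhuis brackets in coordinates). Let A_μ : U → M_m(ℂ) be smooth and satisfy, for all μ,ν: (I) Σ_κ [ N₁^κ_μ ∂_κ A_ν − N₁^κ_ν ∂_κ A_μ + (∂_ν N₁^κ_μ − ∂_μ N₁^κ_ν) A_κ ] = 0 and (II) Σ_κ [ N₂^κ_μ ∂_κ A_ν − N₂^κ_ν ∂_κ A_μ + (∂_ν N₂^κ_μ − ∂_μ N₂^κ_ν) A_κ ] = [A_μ, A_ν]. Let P, Q, κ_μ, λ_μ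 : U → M_r(ℂ) be smooth and satisfy, for all μ,ν: Σ_ν N₂^ν_μ ∂_ν P − [κ_μ, P] = Σ_ν N₁^ν_μ · P ∂_ν P; Σ_ν N₂^ν_μ ∂_ν Q + [λ_μ, Q] = Σ_ν N₁^ν_μ · (∂_ν Q) Q; Σ_κ [ N₂^κ_μ ∂_κ κ_ν − N₂^κ_ν ∂_κ κ_μ + (∂_ν N₂^κ_μ − ∂_μ N₂^κ_ν) κ_κ ] − [κ_μ, κ_ν] = P · Σ_κ [ N₁^κ_μ ∂_κ κ_ν − N₁^κ_ν ∂_κ κ_μ + (∂_ν N₁^κ_μ − ∂_μ N₁^κ_ν) κ_κ ]; Σ_κ [ N₂^κ_μ ∂_κ λ_ν − N₂^κ_ν ∂_κ λ_μ + (∂_ν N₂^κ_μ − ∂_μ N₂^κ_ν) λ_κ ] + [λ_μ, λ_ν] = ( Σ_κ [ N₁^κ_μ ∂_κ λ_ν − N₁^κ_ν ∂_κ λ_μ + (∂_ν N₁^κ_μ − ∂_μ N₁^κ_ν) λ_κ ] ) · Q. Let θ : U → M_{m×r}(ℂ) and η : U → M_{r×m}(ℂ) be smooth solutions of Σ_ν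 ∂_ν θ · ( N₂^ν_μ I_r − N₁^ν_μ Q ) = A_μ θ + θ λ_μ and Σ_ν ( N₂^ν_μ I_r − N₁^ν_μ P ) ∂_ν η = − η A_μ + κ_μ η for all μ. Finally, let Ω : U → M_r(ℂ) be a smooth solution of P Ω − Ω Q = η θ and Σ_ν N₂^ν_μ ∂_ν Ω = Σ_ν N₁^ν_μ ( (∂_ν Ω) Q − (∂_ν P) Ω + (∂_ν η) θ ) + κ_μ Ω + Ω λ_μ for all μ. Then on any open subset of U where Ω is invertible, the matrices A'_μ := A_μ − Σ_κ N₁^κ_μ ∂_κ ( θ Ω^{-1} η ) again satisfy equations (I) and (II). -/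

import Mathlib

open scoped BigOperators

/-- Partial derivative of a real-valued function on `ℝⁿ` in the `μ`-th coordinate direction. -/
noncomputable def pd {n : ℕ} (μ : Fin n) (f : (Fin n → ℝ) → ℝ) (x : Fin n → ℝ) : ℝ :=
  fderiv ℝ f x (Pi.single μ 1)

/-- Entrywise partial derivative of a matrix-valued function on `ℝⁿ`. -/
noncomputable def pdM {n m r : ℕ} (μ : Fin n) (f : (Fin n → ℝ) → Matrix (Fin m) (Fin r) ℂ)
    (x : Fin n → ℝ) : Matrix (Fin m) (Fin r) ℂ :=
  Matrix.of fun i j => fderiv ℝ (fun y => f y i j) x (Pi.single μ 1)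

/-- Coordinate Frölicher–Nijenhuis bracket of two matrices of functions. -/
noncomputable def FNb {n : ℕ} (N M : Fin n → Fin n → (Fin n → ℝ) → ℝ)
    (l μ ν : Fin n) (x : Fin n → ℝ) : ℝ :=
  ∑ κ, (N κ μ x * pd κ (M l ν) x - N κ ν x * pd κ (M l μ) x
      + M κ μ x * pd κ (N l ν) x - M κ ν x * pd κ (N l μ) x
      + N l κ x * (pd ν (M κ μ) x - pd μ (M κ ν) x)
      + M l κ x * (pd ν (N κ μ) x - pd μ (N κ ν) x))

/-- The coordinate expression `Σ_κ [ N^κ_μ ∂_κ A_ν − N^κ_ν ∂_κ A_μ + (∂_ν N^κ_μ − ∂_μ N^κ_ν) A_κ ]`. -/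
noncomputable def dNA {n m r : ℕ} (N : Fin n → Fin n → (Fin n → ℝ) → ℝ)
    (A : Fin n → (Fin n → ℝ) → Matrix (Fin m) (Fin r) ℂ) (μ ν : Fin n)
    (x : Fin n → ℝ) : Matrix (Fin m) (Fin r) ℂ :=
  ∑ κ, (N κ μ x • pdM κ (A ν) x - N κ ν x • pdM κ (A μ) x
      + (pd ν (N κ μ) x - pd μ (N κ ν) x) • A κ x)

open Topology Filter

/-- Entrywise smoothness at a point of a matrix-valued function. -/
def SmoothMatrixAt {n m r : ℕ} (f : (Fin n → ℝ) → Matrix (Fin m) (Fin r) ℂ)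
    (x : Fin n → ℝ) : Prop :=
  ∀ i j, ContDiffAt ℝ (⊤ : ℕ∞) (fun y => f y i j) x

/-- The one-form `d_N f`, with components `Σ_κ N^κ_μ ∂_κ f`. -/
noncomputable def dN {n m r : ℕ} (N : Fin n → Fin n → (Fin n → ℝ) → ℝ) (μ : Fin n)
    (f : (Fin n → ℝ) → Matrix (Fin m) (Fin r) ℂ) (x : Fin n → ℝ) :
    Matrix (Fin m) (Fin r) ℂ :=
  ∑ κ, N κ μ x • pdM κ f x

section Calculus

variable {n m r k : ℕ} {x : Fin n → ℝ}

namespace SmoothMatrixAt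

lemma differentiableAt {f : (Fin n → ℝ) → Matrix (Fin m) (Fin r) ℂ} (hf : SmoothMatrixAt f x)
    (i : Fin m) (j : Fin r) : DifferentiableAt ℝ (fun y => f y i j) x :=
  (hf i j).differentiableAt (by simp)

lemma add {f g : (Fin n → ℝ) → Matrix (Fin m) (Fin r) ℂ} (hf : SmoothMatrixAt f x)
    (hg : SmoothMatrixAt g x) : SmoothMatrixAt (fun y => f y + g y) x :=
  fun i j => (hf i j).add (hg i j)

lemma sub {f g : (Fin n → ℝ) → Matrix (Fin m) (Fin r) ℂ} (hf : SmoothMatrixAt f x)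
    (hg : SmoothMatrixAt g x) : SmoothMatrixAt (fun y => f y - g y) x :=
  fun i j => (hf i j).sub (hg i j)

lemma mul {f : (Fin n → ℝ) → Matrix (Fin m) (Fin r) ℂ}
    {g : (Fin n → ℝ) → Matrix (Fin r) (Fin k) ℂ} (hf : SmoothMatrixAt f x)
    (hg : SmoothMatrixAt g x) : SmoothMatrixAt (fun y => f y * g y) x := by
  intro i j
  simp only [Matrix.mul_apply]
  exact ContDiffAt.sum fun l _ => (hf i l).mul (hg l j)

lemma pdM {f : (Fin n → ℝ) → Matrix (Fin m) (Fin r) ℂ} (hf : SmoothMatrixAt f x) (μ : Fin n) :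
    SmoothMatrixAt (pdM μ f) x := fun i j =>
  ((hf i j).fderiv_right (m := (⊤ : ℕ∞)) (by simp)).clm_apply contDiffAt_const

lemma dN {N : Fin n → Fin n → (Fin n → ℝ) → ℝ}
    (hN : ∀ μ ν, ContDiffAt ℝ (⊤ : ℕ∞) (N μ ν) x)
    {f : (Fin n → ℝ) → Matrix (Fin m) (Fin r) ℂ} (hf : SmoothMatrixAt f x) (μ : Fin n) :
    SmoothMatrixAt (dN N μ f) x := by
  intro i j
  simp only [_root_.dN, Matrix.sum_apply, Matrix.smul_apply]
  exact ContDiffAt.sum fun κ _ => (hN κ μ).smul (hf.pdM κ i j)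

lemma det {f : (Fin n → ℝ) → Matrix (Fin r) (Fin r) ℂ} (hf : SmoothMatrixAt f x) :
    ContDiffAt ℝ (⊤ : ℕ∞) (fun y => (f y).det) x := by
  simp only [Matrix.det_apply']
  exact ContDiffAt.sum fun σ _ => contDiffAt_const.mul (contDiffAt_prod fun i _ => hf _ _)

lemma inv {f : (Fin n → ℝ) → Matrix (Fin r) (Fin r) ℂ} (hf : SmoothMatrixAt f x)
    (hx : IsUnit (f x)) : SmoothMatrixAt (fun y => (f y)⁻¹) x := by
  intro i j
  simp only [Matrix.inv_def, Ring.inverse_eq_inv', Matrix.smul_apply, Matrix.adjugate_apply,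
    smul_eq_mul]
  refine (hf.det.inv ((Matrix.isUnit_iff_isUnit_det _).1 hx).ne_zero).mul (det ?_)
  intro a b
  by_cases h : a = j
  · subst h
    simpa using contDiffAt_const
  · simpa [Matrix.updateRow_ne h] using hf a b

end SmoothMatrixAt

lemma pdM_congr {f g : (Fin n → ℝ) → Matrix (Fin m) (Fin r) ℂ} (h : f =ᶠ[𝓝 x] g) (μ : Fin n) :
    pdM μ f x = pdM μ g x := by
  ext i j
  have h' : (fun y => f y i j) =ᶠ[𝓝 x] fun y => g y i j := by
    filter_upwards [h] with y hy
    rw [hy]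
  simp [pdM, h'.fderiv_eq]

lemma pdM_add {f g : (Fin n → ℝ) → Matrix (Fin m) (Fin r) ℂ} (hf : SmoothMatrixAt f x)
    (hg : SmoothMatrixAt g x) (μ : Fin n) :
    pdM μ (fun y => f y + g y) x = pdM μ f x + pdM μ g x := by
  ext i j
  simp [pdM, fderiv_fun_add (hf.differentiableAt i j) (hg.differentiableAt i j)]

lemma pdM_sub {f g : (Fin n → ℝ) → Matrix (Fin m) (Fin r) ℂ} (hf : SmoothMatrixAt f x)
    (hg : SmoothMatrixAt g x) (μ : Fin n) :
    pdM μ (fun y => f y - g y) x = pdM μ f x - pdM μ g x := by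
  ext i j
  simp [pdM, fderiv_fun_sub (hf.differentiableAt i j) (hg.differentiableAt i j)]

lemma pdM_mul {f : (Fin n → ℝ) → Matrix (Fin m) (Fin r) ℂ}
    {g : (Fin n → ℝ) → Matrix (Fin r) (Fin k) ℂ} (hf : SmoothMatrixAt f x)
    (hg : SmoothMatrixAt g x) (μ : Fin n) :
    pdM μ (fun y => f y * g y) x = pdM μ f x * g x + f x * pdM μ g x := by
  ext i j
  simp only [pdM, Matrix.mul_apply, Matrix.of_apply, Matrix.add_apply]
  rw [fderiv_fun_sum fun l _ => (hf.differentiableAt i l).fun_mul (hg.differentiableAt l j)]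
  simp only [sum_apply, ← Finset.sum_add_distrib]
  refine Finset.sum_congr rfl fun l _ => ?_
  rw [fderiv_fun_mul (hf.differentiableAt i l) (hg.differentiableAt l j)]
  simp
  ring

lemma pdM_const (c : Matrix (Fin m) (Fin r) ℂ) (μ : Fin n) : pdM μ (fun _ => c) x = 0 := by
  ext i j
  simp [pdM]

variable {N M : Fin n → Fin n → (Fin n → ℝ) → ℝ}

lemma dN_mul {f : (Fin n → ℝ) → Matrix (Fin m) (Fin r) ℂ}
    {g : (Fin n → ℝ) → Matrix (Fin r) (Fin k) ℂ} (hf : SmoothMatrixAt f x)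
    (hg : SmoothMatrixAt g x) (μ : Fin n) :
    dN N μ (fun y => f y * g y) x = dN N μ f x * g x + f x * dN N μ g x := by
  simp only [dN, pdM_mul hf hg, smul_add, Finset.sum_add_distrib, Matrix.sum_mul, Matrix.mul_sum,
    Matrix.smul_mul, Matrix.mul_smul]

lemma dN_inv {f : (Fin n → ℝ) → Matrix (Fin r) (Fin r) ℂ} (hf : SmoothMatrixAt f x)
    (hu : ∀ᶠ y in 𝓝 x, IsUnit (f y)) (μ : Fin n) :
    dN N μ (fun y => (f y)⁻¹) x = -((f x)⁻¹ * dN N μ f x * (f x)⁻¹) := by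
  have hx := (Matrix.isUnit_iff_isUnit_det _).1 hu.self_of_nhds
  have h : dN N μ (fun y => f y * (f y)⁻¹) x = 0 := by
    have : (fun y => f y * (f y)⁻¹) =ᶠ[𝓝 x] fun _ => 1 := by
      filter_upwards [hu] with y hy
      exact Matrix.mul_nonsing_inv _ ((Matrix.isUnit_iff_isUnit_det _).1 hy)
    simp [dN, pdM_congr this, pdM_const]
  rw [dN_mul hf (hf.inv hu.self_of_nhds)] at h
  have h' := congrArg ((f x)⁻¹ * ·) (eq_neg_of_add_eq_zero_right h)
  simpa [← Matrix.mul_assoc, Matrix.nonsing_inv_mul _ hx] using h'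

lemma dNA_congr {A B : Fin n → (Fin n → ℝ) → Matrix (Fin m) (Fin r) ℂ}
    (h : ∀ μ, A μ =ᶠ[𝓝 x] B μ) (μ ν : Fin n) : dNA N A μ ν x = dNA N B μ ν x := by
  simp only [dNA, fun κ ρ => pdM_congr (h ρ) κ, fun κ => (h κ).self_of_nhds]

lemma dNA_add {A B : Fin n → (Fin n → ℝ) → Matrix (Fin m) (Fin r) ℂ}
    (hA : ∀ μ, SmoothMatrixAt (A μ) x) (hB : ∀ μ, SmoothMatrixAt (B μ) x) (μ ν : Fin n) :
    dNA N (fun μ y => A μ y + B μ y) μ ν x = dNA N A μ ν x + dNA N B μ ν x := by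
  simp only [dNA, fun κ ρ => pdM_add (hA ρ) (hB ρ) κ, ← Finset.sum_add_distrib]
  refine Finset.sum_congr rfl fun κ _ => ?_
  module

lemma dNA_sub {A B : Fin n → (Fin n → ℝ) → Matrix (Fin m) (Fin r) ℂ}
    (hA : ∀ μ, SmoothMatrixAt (A μ) x) (hB : ∀ μ, SmoothMatrixAt (B μ) x) (μ ν : Fin n) :
    dNA N (fun μ y => A μ y - B μ y) μ ν x = dNA N A μ ν x - dNA N B μ ν x := by
  simp only [dNA, fun κ ρ => pdM_sub (hA ρ) (hB ρ) κ, ← Finset.sum_sub_distrib]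
  refine Finset.sum_congr rfl fun κ _ => ?_
  module

/-- Graded Leibniz rule for a one-form times a function. -/
lemma dNA_mul_right {B : Fin n → (Fin n → ℝ) → Matrix (Fin m) (Fin r) ℂ}
    {f : (Fin n → ℝ) → Matrix (Fin r) (Fin k) ℂ}
    (hB : ∀ μ, SmoothMatrixAt (B μ) x) (hf : SmoothMatrixAt f x) (μ ν : Fin n) :
    dNA N (fun μ y => B μ y * f y) μ ν x
      = dNA N B μ ν x * f x + B ν x * dN N μ f x - B μ x * dN N ν f x := by
  simp only [dNA, dN, fun κ ρ => pdM_mul (hB ρ) hf κ, Matrix.sum_mul, Matrix.mul_sum,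
    ← Finset.sum_add_distrib, ← Finset.sum_sub_distrib]
  refine Finset.sum_congr rfl fun κ _ => ?_
  simp only [Matrix.add_mul, Matrix.sub_mul, Matrix.smul_mul, Matrix.mul_smul]
  module

/-- Graded Leibniz rule for a function times a one-form. -/
lemma dNA_mul_left {B : Fin n → (Fin n → ℝ) → Matrix (Fin r) (Fin k) ℂ}
    {f : (Fin n → ℝ) → Matrix (Fin m) (Fin r) ℂ}
    (hB : ∀ μ, SmoothMatrixAt (B μ) x) (hf : SmoothMatrixAt f x) (μ ν : Fin n) :
    dNA N (fun μ y => f y * B μ y) μ ν x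
      = f x * dNA N B μ ν x + dN N μ f x * B ν x - dN N ν f x * B μ x := by
  simp only [dNA, dN, fun κ ρ => pdM_mul hf (hB ρ) κ, Matrix.sum_mul, Matrix.mul_sum,
    ← Finset.sum_add_distrib, ← Finset.sum_sub_distrib]
  refine Finset.sum_congr rfl fun κ _ => ?_
  simp only [Matrix.mul_add, Matrix.mul_sub, Matrix.smul_mul, Matrix.mul_smul]
  module

lemma pdM_dN (hN : ∀ μ ν, ContDiffAt ℝ (⊤ : ℕ∞) (N μ ν) x)
    {f : (Fin n → ℝ) → Matrix (Fin m) (Fin r) ℂ} (hf : SmoothMatrixAt f x) (κ μ : Fin n) :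
    pdM κ (dN N μ f) x
      = ∑ l, (pd κ (N l μ) x • pdM l f x + N l μ x • pdM κ (pdM l f) x) := by
  ext i j
  have hN' := fun l => (hN l μ).differentiableAt (by simp)
  have hf' := fun l => (hf.pdM l).differentiableAt i j
  have h : (fun y => dN N μ f y i j) = fun y => ∑ l, N l μ y • pdM l f y i j := by
    simp only [dN, Matrix.sum_apply, Matrix.smul_apply]
  rw [pdM, Matrix.of_apply, h, fderiv_fun_sum fun l _ => (hN' l).fun_smul (hf' l)]
  simp only [Matrix.sum_apply, Matrix.smul_apply, Matrix.add_apply]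
  simp only [sum_apply]
  refine Finset.sum_congr rfl fun l _ => ?_
  rw [fderiv_fun_smul (hN' l) (hf' l)]
  simp [pd, pdM, add_comm]

lemma pdM_comm {f : (Fin n → ℝ) → Matrix (Fin m) (Fin r) ℂ} (hf : SmoothMatrixAt f x)
    (μ ν : Fin n) : pdM μ (pdM ν f) x = pdM ν (pdM μ f) x := by
  ext i j
  have hd : DifferentiableAt ℝ (fderiv ℝ fun y => f y i j) x :=
    ((hf i j).fderiv_right (m := (⊤ : ℕ∞)) (by simp)).differentiableAt (by simp)
  have hsymm : IsSymmSndFDerivAt ℝ (fun y => f y i j) x :=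
    (hf i j).isSymmSndFDerivAt <| by
      rw [minSmoothness_of_isRCLikeNormedField]
      exact WithTop.coe_le_coe.2 (le_top : (2 : ℕ∞) ≤ ⊤)
  simp only [pdM, Matrix.of_apply]
  rw [fderiv_clm_apply hd (differentiableAt_const _), fderiv_clm_apply hd (differentiableAt_const _)]
  simpa using hsymm.eq _ _

/-- The anticommutator of `d_N` and `d_M` on functions is given by the Frölicher–Nijenhuis
bracket. -/
lemma dNA_dN_add_dNA_dN (hN : ∀ μ ν, ContDiffAt ℝ (⊤ : ℕ∞) (N μ ν) x)
    (hM : ∀ μ ν, ContDiffAt ℝ (⊤ : ℕ∞) (M μ ν) x)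
    {f : (Fin n → ℝ) → Matrix (Fin m) (Fin r) ℂ} (hf : SmoothMatrixAt f x) (μ ν : Fin n) :
    dNA N (fun μ => dN M μ f) μ ν x + dNA M (fun μ => dN N μ f) μ ν x
      = ∑ l, FNb N M l μ ν x • pdM l f x := by
  have key : ∀ a b : Fin n → Fin n → (Fin n → ℝ) → ℝ, ∀ μ ν,
      ∑ κ, ∑ l, (a κ μ x * b l ν x) • pdM κ (pdM l f) x
        = ∑ κ, ∑ l, (b κ ν x * a l μ x) • pdM κ (pdM l f) x := by
    intro a b μ ν
    rw [Finset.sum_comm]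
    refine Finset.sum_congr rfl fun κ _ => Finset.sum_congr rfl fun l _ => ?_
    rw [pdM_comm hf, mul_comm]
  have h1 := key N M μ ν
  have h2 := key M N μ ν
  simp only [FNb, Finset.sum_smul]
  rw [Finset.sum_comm]
  simp only [dNA, pdM_dN hN hf, pdM_dN hM hf]
  simp only [dN, Finset.smul_sum, smul_add, smul_smul, add_smul, sub_smul,
    mul_sub, sub_mul, Finset.sum_add_distrib, Finset.sum_sub_distrib] at h1 h2 ⊢
  rw [h1, h2]
  simp only [mul_comm]
  abel

end Calculus

lemma binaryDarboux_identity {m r : ℕ} {A X₁ : Matrix (Fin m) (Fin m) ℂ}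
    {P Q κ l Ω W dP d₁Ω d₂Ω : Matrix (Fin r) (Fin r) ℂ}
    {θ d₁θ d₂θ : Matrix (Fin m) (Fin r) ℂ} {η d₁η d₂η : Matrix (Fin r) (Fin m) ℂ}
    (hΩW : Ω * W = 1) (hWΩ : W * Ω = 1)
    (hθ : d₂θ - d₁θ * Q = A * θ + θ * l) (hη : d₂η - P * d₁η = -(η * A) + κ * η)
    (hS : P * Ω - Ω * Q = η * θ)
    (hΩ : d₂Ω = d₁Ω * Q - dP * Ω + d₁η * θ + κ * Ω + Ω * l)
    (hX₁ : X₁ = (d₁θ * W + θ * -(W * d₁Ω * W)) * η + θ * W * d₁η) :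
    (d₂θ * W + θ * -(W * d₂Ω * W)) * η + θ * W * d₂η
      = A * (θ * W * η) - θ * W * η * A
        + ((d₁θ * W + θ * -(W * d₁Ω * W)) * (P * η) + θ * W * (dP * η + P * d₁η))
        - X₁ * (θ * W * η) := by
  have hQW : Q * W = W * P - W * (η * (θ * W)) := by
    have : W * (P * Ω - Ω * Q) * W = W * (η * θ) * W := by rw [hS]
    rw [Matrix.mul_sub, Matrix.sub_mul, ← Matrix.mul_assoc W Ω, hWΩ, Matrix.one_mul,
      Matrix.mul_assoc W, Matrix.mul_assoc P, hΩW, Matrix.mul_one] at this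
    rw [← Matrix.mul_assoc η, ← Matrix.mul_assoc W, ← this]
    abel
  have hQW' : ∀ Y : Matrix (Fin r) (Fin m) ℂ,
      Q * (W * Y) = W * (P * Y) - W * (η * (θ * (W * Y))) := fun Y => by
    rw [← Matrix.mul_assoc, hQW]
    simp only [Matrix.sub_mul, Matrix.mul_assoc]
  have hΩW' : ∀ Y : Matrix (Fin r) (Fin m) ℂ, Ω * (W * Y) = Y := fun Y => by
    rw [← Matrix.mul_assoc, hΩW, Matrix.one_mul]
  have hWΩ' : ∀ Y : Matrix (Fin r) (Fin m) ℂ, W * (Ω * Y) = Y := fun Y => by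
    rw [← Matrix.mul_assoc, hWΩ, Matrix.one_mul]
  rw [sub_eq_iff_eq_add] at hθ hη
  subst hX₁ hΩ hθ hη
  simp only [Matrix.mul_add, Matrix.add_mul, Matrix.mul_sub, Matrix.sub_mul, Matrix.mul_neg,
    Matrix.neg_mul, Matrix.mul_assoc, hQW', hΩW', hWΩ']
  abel

/-- coordinate form of the binary Darboux transformation. -/
theorem statement6 {n m r : ℕ} (U : Set (Fin n → ℝ)) (hU : IsOpen U)
    (N₁ N₂ : Fin n → Fin n → (Fin n → ℝ) → ℝ)
    (hN₁s : ∀ μ ν, ContDiffOn ℝ (⊤ : ℕ∞) (N₁ μ ν) U)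
    (hN₂s : ∀ μ ν, ContDiffOn ℝ (⊤ : ℕ∞) (N₂ μ ν) U)
    (hFN11 : ∀ x ∈ U, ∀ l μ ν, FNb N₁ N₁ l μ ν x = 0)
    (hFN12 : ∀ x ∈ U, ∀ l μ ν, FNb N₁ N₂ l μ ν x = 0)
    (hFN22 : ∀ x ∈ U, ∀ l μ ν, FNb N₂ N₂ l μ ν x = 0)
    (A : Fin n → (Fin n → ℝ) → Matrix (Fin m) (Fin m) ℂ)
    (hAs : ∀ μ i j, ContDiffOn ℝ (⊤ : ℕ∞) (fun y => A μ y i j) U)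
    (hAI : ∀ x ∈ U, ∀ μ ν, dNA N₁ A μ ν x = 0)
    (hAII : ∀ x ∈ U, ∀ μ ν, dNA N₂ A μ ν x = A μ x * A ν x - A ν x * A μ x)
    (P Q : (Fin n → ℝ) → Matrix (Fin r) (Fin r) ℂ)
    (kap lam : Fin n → (Fin n → ℝ) → Matrix (Fin r) (Fin r) ℂ)
    (hPs : ∀ i j, ContDiffOn ℝ (⊤ : ℕ∞) (fun y => P y i j) U)
    (hQs : ∀ i j, ContDiffOn ℝ (⊤ : ℕ∞) (fun y => Q y i j) U)
    (hkaps : ∀ μ i j, ContDiffOn ℝ (⊤ : ℕ∞) (fun y => kap μ y i j) U)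
    (hlams : ∀ μ i j, ContDiffOn ℝ (⊤ : ℕ∞) (fun y => lam μ y i j) U)
    (hP : ∀ x ∈ U, ∀ μ, (∑ ν, N₂ ν μ x • pdM ν P x) - (kap μ x * P x - P x * kap μ x)
        = ∑ ν, N₁ ν μ x • (P x * pdM ν P x))
    (hQ : ∀ x ∈ U, ∀ μ, (∑ ν, N₂ ν μ x • pdM ν Q x) + (lam μ x * Q x - Q x * lam μ x)
        = ∑ ν, N₁ ν μ x • (pdM ν Q x * Q x))
    (hkap : ∀ x ∈ U, ∀ μ ν, dNA N₂ kap μ ν x - (kap μ x * kap ν x - kap ν x * kap μ x)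
        = P x * dNA N₁ kap μ ν x)
    (hlam : ∀ x ∈ U, ∀ μ ν, dNA N₂ lam μ ν x + (lam μ x * lam ν x - lam ν x * lam μ x)
        = dNA N₁ lam μ ν x * Q x)
    (θ : (Fin n → ℝ) → Matrix (Fin m) (Fin r) ℂ)
    (η : (Fin n → ℝ) → Matrix (Fin r) (Fin m) ℂ)
    (hθs : ∀ i j, ContDiffOn ℝ (⊤ : ℕ∞) (fun y => θ y i j) U)
    (hηs : ∀ i j, ContDiffOn ℝ (⊤ : ℕ∞) (fun y => η y i j) U)
    (hθ : ∀ x ∈ U, ∀ μ,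
        ∑ ν, pdM ν θ x * (N₂ ν μ x • (1 : Matrix (Fin r) (Fin r) ℂ) - N₁ ν μ x • Q x)
        = A μ x * θ x + θ x * lam μ x)
    (hη : ∀ x ∈ U, ∀ μ,
        ∑ ν, (N₂ ν μ x • (1 : Matrix (Fin r) (Fin r) ℂ) - N₁ ν μ x • P x) * pdM ν η x
        = -(η x * A μ x) + kap μ x * η x)
    (Ω : (Fin n → ℝ) → Matrix (Fin r) (Fin r) ℂ)
    (hΩs : ∀ i j, ContDiffOn ℝ (⊤ : ℕ∞) (fun y => Ω y i j) U)
    (hSylv : ∀ x ∈ U, P x * Ω x - Ω x * Q x = η x * θ x)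
    (hΩ : ∀ x ∈ U, ∀ μ, ∑ ν, N₂ ν μ x • pdM ν Ω x
        = (∑ ν, N₁ ν μ x • (pdM ν Ω x * Q x - pdM ν P x * Ω x + pdM ν η x * θ x))
          + kap μ x * Ω x + Ω x * lam μ x)
    (A' : Fin n → (Fin n → ℝ) → Matrix (Fin m) (Fin m) ℂ)
    (hA' : A' = fun μ x => A μ x - ∑ κ, N₁ κ μ x • pdM κ (fun y => θ y * (Ω y)⁻¹ * η y) x) :
    ∀ V : Set (Fin n → ℝ), IsOpen V → V ⊆ U → (∀ x ∈ V, IsUnit (Ω x)) →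
      ∀ x ∈ V, ∀ μ ν, dNA N₁ A' μ ν x = 0 ∧
        dNA N₂ A' μ ν x = A' μ x * A' ν x - A' ν x * A' μ x := by
  intro V hV hVU hunit x hx
  subst hA'
  have hnhd : ∀ {y}, y ∈ V → U ∈ 𝓝 y := fun hy => hU.mem_nhds (hVU hy)
  have hN₁ : ∀ {y}, y ∈ V → ∀ μ ν, ContDiffAt ℝ (⊤ : ℕ∞) (N₁ μ ν) y :=
    fun hy μ ν => (hN₁s μ ν).contDiffAt (hnhd hy)
  have hN₂ : ∀ {y}, y ∈ V → ∀ μ ν, ContDiffAt ℝ (⊤ : ℕ∞) (N₂ μ ν) y :=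
    fun hy μ ν => (hN₂s μ ν).contDiffAt (hnhd hy)
  have sA : ∀ {y}, y ∈ V → ∀ μ, SmoothMatrixAt (A μ) y :=
    fun hy μ i j => (hAs μ i j).contDiffAt (hnhd hy)
  have sP : ∀ {y}, y ∈ V → SmoothMatrixAt P y := fun hy i j => (hPs i j).contDiffAt (hnhd hy)
  have sθ : ∀ {y}, y ∈ V → SmoothMatrixAt θ y := fun hy i j => (hθs i j).contDiffAt (hnhd hy)
  have sη : ∀ {y}, y ∈ V → SmoothMatrixAt η y := fun hy i j => (hηs i j).contDiffAt (hnhd hy)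
  have sΩ : ∀ {y}, y ∈ V → SmoothMatrixAt Ω y := fun hy i j => (hΩs i j).contDiffAt (hnhd hy)
  have sW : ∀ {y}, y ∈ V → SmoothMatrixAt (fun y => (Ω y)⁻¹) y :=
    fun hy => (sΩ hy).inv (hunit _ hy)
  have sθW : ∀ {y}, y ∈ V → SmoothMatrixAt (fun y => θ y * (Ω y)⁻¹) y :=
    fun hy => (sθ hy).mul (sW hy)
  have sPη : ∀ {y}, y ∈ V → SmoothMatrixAt (fun y => P y * η y) y := fun hy => (sP hy).mul (sη hy)
  let φ : (Fin n → ℝ) → Matrix (Fin m) (Fin m) ℂ := fun y => θ y * (Ω y)⁻¹ * η y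
  let ψ : (Fin n → ℝ) → Matrix (Fin m) (Fin m) ℂ := fun y => θ y * (Ω y)⁻¹ * (P y * η y)
  have sφ : ∀ {y}, y ∈ V → SmoothMatrixAt φ y := fun hy => (sθW hy).mul (sη hy)
  have sψ : ∀ {y}, y ∈ V → SmoothMatrixAt ψ y := fun hy => (sθW hy).mul (sPη hy)
  have hdφ : ∀ y ∈ V, ∀ μ, dN N₂ μ φ y
      = A μ y * φ y - φ y * A μ y + dN N₁ μ ψ y - dN N₁ μ φ y * φ y := by
    intro y hy μ
    have hu : ∀ᶠ z in 𝓝 y, IsUnit (Ω z) := by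
      filter_upwards [hV.mem_nhds hy] with z hz using hunit z hz
    have hdet := (Matrix.isUnit_iff_isUnit_det _).1 (hunit y hy)
    have eφ : ∀ N : Fin n → Fin n → (Fin n → ℝ) → ℝ, dN N μ φ y
        = (dN N μ θ y * (Ω y)⁻¹ + θ y * -((Ω y)⁻¹ * dN N μ Ω y * (Ω y)⁻¹)) * η y
          + θ y * (Ω y)⁻¹ * dN N μ η y := fun N => by
      rw [dN_mul (sθW hy) (sη hy), dN_mul (sθ hy) (sW hy), dN_inv (sΩ hy) hu]
    rw [eφ N₂, dN_mul (sθW hy) (sPη hy), dN_mul (sθ hy) (sW hy), dN_inv (sΩ hy) hu,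
      dN_mul (sP hy) (sη hy)]
    refine binaryDarboux_identity (Matrix.mul_nonsing_inv _ hdet) (Matrix.nonsing_inv_mul _ hdet)
      (Q := Q y) (κ := kap μ y) (l := lam μ y) ?_ ?_ (hSylv y (hVU hy)) ?_ (eφ N₁)
    · rw [← hθ y (hVU hy) μ]
      simp only [dN, Matrix.mul_sub, Matrix.mul_smul, Matrix.mul_one, Finset.sum_sub_distrib,
        Matrix.sum_mul, Matrix.smul_mul]
    · rw [← hη y (hVU hy) μ]
      simp only [dN, Matrix.sub_mul, Matrix.mul_smul, Matrix.one_mul, Finset.sum_sub_distrib,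
        Matrix.mul_sum, Matrix.smul_mul]
    · rw [dN, hΩ y (hVU hy) μ]
      simp only [dN, smul_add, smul_sub, Finset.sum_sub_distrib, Finset.sum_add_distrib,
        Matrix.sum_mul, Matrix.smul_mul]
  have hdd : ∀ {f : (Fin n → ℝ) → Matrix (Fin m) (Fin m) ℂ}, SmoothMatrixAt f x → ∀ μ ν,
      dNA N₁ (fun μ => dN N₁ μ f) μ ν x = 0 := by
    intro f hf μ ν
    have h := dNA_dN_add_dNA_dN (hN₁ hx) (hN₁ hx) hf μ ν
    simp only [hFN11 x (hVU hx), zero_smul, Finset.sum_const_zero] at h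
    rwa [← two_nsmul, two_nsmul, ← two_smul ℂ, smul_eq_zero_iff_right two_ne_zero] at h
  have sdφ : ∀ μ, SmoothMatrixAt (dN N₁ μ φ) x := (sφ hx).dN (hN₁ hx)
  intro μ ν
  change dNA N₁ (fun μ y => A μ y - dN N₁ μ φ y) μ ν x = 0 ∧
    dNA N₂ (fun μ y => A μ y - dN N₁ μ φ y) μ ν x
      = (A μ x - dN N₁ μ φ x) * (A ν x - dN N₁ ν φ x)
        - (A ν x - dN N₁ ν φ x) * (A μ x - dN N₁ μ φ x)
  refine ⟨?_, ?_⟩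
  · rw [dNA_sub (sA hx) sdφ, hAI x (hVU hx), hdd (sφ hx), sub_zero]
  · have hanti := dNA_dN_add_dNA_dN (hN₁ hx) (hN₂ hx) (sφ hx) μ ν
    simp only [hFN12 x (hVU hx), zero_smul, Finset.sum_const_zero] at hanti
    have hcongr : dNA N₁ (fun μ => dN N₂ μ φ) μ ν x
        = dNA N₁ (fun μ y => A μ y * φ y - φ y * A μ y + dN N₁ μ ψ y - dN N₁ μ φ y * φ y)
          μ ν x := by
      refine dNA_congr (fun ρ => ?_) μ ν
      filter_upwards [hV.mem_nhds hx] with y hy using hdφ y hy ρ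
    have sAφ : ∀ μ, SmoothMatrixAt (fun y => A μ y * φ y) x := fun μ => (sA hx μ).mul (sφ hx)
    have sφA : ∀ μ, SmoothMatrixAt (fun y => φ y * A μ y) x := fun μ => (sφ hx).mul (sA hx μ)
    have sdψ : ∀ μ, SmoothMatrixAt (dN N₁ μ ψ) x := (sψ hx).dN (hN₁ hx)
    rw [dNA_sub (fun μ => ((sAφ μ).sub (sφA μ)).add (sdψ μ)) (fun μ => (sdφ μ).mul (sφ hx)),
      dNA_add (fun μ => (sAφ μ).sub (sφA μ)) sdψ, dNA_sub sAφ sφA,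
      dNA_mul_right (sA hx) (sφ hx), dNA_mul_left (sA hx) (sφ hx),
      dNA_mul_right sdφ (sφ hx), hdd (sφ hx), hdd (sψ hx), hAI x (hVU hx)] at hcongr
    rw [dNA_sub (sA hx) sdφ, hAII x (hVU hx), eq_neg_of_add_eq_zero_right hanti, hcongr]
    noncomm_ring
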